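/- arXiv:1308.0002 — 3 statements merged into one kernel-verified Lean document; each statement's English description precedes it below -/
import Mathlib

section
/- Suppose P > 0 solves the discrete algebraic Riccati equation P = A^TPA − A^TPB(B^TPB)^{-1}B^TPA + Q. Then the minimal value of u ↦ ‖Gu − Hx‖₂² equals x^T(P−Q)x for all x ∈ ℝ^n; that is, the smallest covariance matrix W* for the feasible set satisfies W* = P − Q. -/
open Matrix Filter Topology

noncomputable section

/-- The block lower-triangular matrix `Φ ∈ ℝ^{nN×N}` whose (i,j)-th `n×1` block
(0-indexed) is `A^{i-j}B` for `i ≥ j` and `0` otherwise. -/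
def Phi (n N : ℕ) (A : Matrix (Fin n) (Fin n) ℝ) (B : Fin n → ℝ) :
    Matrix (Fin N × Fin n) (Fin N) ℝ :=
  Matrix.of fun p j =>
    if (j : ℕ) ≤ (p.1 : ℕ) then ((A ^ ((p.1 : ℕ) - (j : ℕ))) *ᵥ B) p.2 else 0

/-- `Φ_i ∈ ℝ^{n×N}`, the (i+1)-th row block of `Φ`,
i.e. `Φ_i = [A^i B, A^{i-1} B, …, B, 0, …, 0]`. -/
def PhiBlock (n N : ℕ) (A : Matrix (Fin n) (Fin n) ℝ) (B : Fin n → ℝ) (i : Fin N) :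
    Matrix (Fin n) (Fin N) ℝ :=
  Matrix.of fun r j => Phi n N A B (i, r) j

/-- `Υ := [A; A²; …; A^N] ∈ ℝ^{nN×n}`. -/
def Upsilon (n N : ℕ) (A : Matrix (Fin n) (Fin n) ℝ) :
    Matrix (Fin N × Fin n) (Fin n) ℝ :=
  Matrix.of fun p s => (A ^ ((p.1 : ℕ) + 1)) p.2 s

/-- `Q̄ := blockdiag(Q, …, Q, P)` with `N−1` copies of `Q` followed by `P`. -/
def Qbar (n N : ℕ) (Q P : Matrix (Fin n) (Fin n) ℝ) :
    Matrix (Fin N × Fin n) (Fin N × Fin n) ℝ :=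
  Matrix.of fun p q =>
    if p.1 = q.1 then (if (p.1 : ℕ) = N - 1 then P else Q) p.2 q.2 else 0

/-- The cost `u ↦ ‖Gu − Hx‖₂²`. -/
def Jcost {n N : ℕ} (G : Matrix (Fin N × Fin n) (Fin N) ℝ)
    (H : Matrix (Fin N × Fin n) (Fin n) ℝ) (x : Fin n → ℝ) (u : Fin N → ℝ) : ℝ :=
  (G *ᵥ u - H *ᵥ x) ⬝ᵥ (G *ᵥ u - H *ᵥ x)

/-- The feasible set `F_W(x) := {u ∈ ℝ^N : ‖Gu − Hx‖₂² ≤ xᵀWx}`. -/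
def Feas {n N : ℕ} (G : Matrix (Fin N × Fin n) (Fin N) ℝ)
    (H : Matrix (Fin N × Fin n) (Fin n) ℝ) (W : Matrix (Fin n) (Fin n) ℝ)
    (x : Fin n → ℝ) : Set (Fin N → ℝ) :=
  {u | Jcost G H x u ≤ x ⬝ᵥ (W *ᵥ x)}

/-- The least-squares solution `u*(x) := (GᵀG)⁻¹GᵀHx`. -/
def uStar {n N : ℕ} (G : Matrix (Fin N × Fin n) (Fin N) ℝ)
    (H : Matrix (Fin N × Fin n) (Fin n) ℝ) (x : Fin n → ℝ) : Fin N → ℝ :=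
  ((Gᵀ * G)⁻¹ * Gᵀ * H) *ᵥ x

/-- The LQ gain (row vector) `K := −(BᵀPB)⁻¹BᵀPA`. -/
def Kgain {n : ℕ} (A P : Matrix (Fin n) (Fin n) ℝ) (B : Fin n → ℝ) : Fin n → ℝ :=
  -((B ⬝ᵥ (P *ᵥ B))⁻¹ • Matrix.vecMul B (P * A))

/-- The closed-loop matrix `A + BK`. -/
def Acl {n : ℕ} (A P : Matrix (Fin n) (Fin n) ℝ) (B : Fin n → ℝ) :
    Matrix (Fin n) (Fin n) ℝ :=
  A + Matrix.vecMulVec B (Kgain A P B)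

/-- The discrete algebraic Riccati equation
`P = AᵀPA − AᵀPB(BᵀPB)⁻¹BᵀPA + Q`. -/
def Riccati {n : ℕ} (A P Q : Matrix (Fin n) (Fin n) ℝ) (B : Fin n → ℝ) : Prop :=
  P = Aᵀ * P * A -
      (B ⬝ᵥ (P *ᵥ B))⁻¹ •
        Matrix.vecMulVec (Aᵀ *ᵥ (P *ᵥ B)) (Matrix.vecMul B (P * A)) + Q

/-- The Lyapunov function `V(x) := xᵀPx`. -/
def Vfun {n : ℕ} (P : Matrix (Fin n) (Fin n) ℝ) (x : Fin n → ℝ) : ℝ :=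
  x ⬝ᵥ (P *ᵥ x)

/-- `c₁ := max_{i=0,…,N−1} λ_max(Φᵢᵀ P Φᵢ (GᵀG)⁻¹)`. -/
def c1const (n N : ℕ) (A P : Matrix (Fin n) (Fin n) ℝ) (B : Fin n → ℝ)
    (G : Matrix (Fin N × Fin n) (Fin N) ℝ) : ℝ :=
  ⨆ i : Fin N,
    sSup (spectrum ℝ ((PhiBlock n N A B i)ᵀ * P * PhiBlock n N A B i * (Gᵀ * G)⁻¹))

/-- `ρ := 1 − λ_min(QP⁻¹)`. -/
def rhoConst {n : ℕ} (Q P : Matrix (Fin n) (Fin n) ℝ) : ℝ :=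
  1 - sInf (spectrum ℝ (Q * P⁻¹))

/-- `c := (1−ρ)⁻¹(1−ρ^N)c₁`. -/
def cConst (n N : ℕ) (A P Q : Matrix (Fin n) (Fin n) ℝ) (B : Fin n → ℝ)
    (G : Matrix (Fin N × Fin n) (Fin N) ℝ) : ℝ :=
  (1 - rhoConst Q P)⁻¹ * (1 - rhoConst Q P ^ N) * c1const n N A P B G

/-- `w_i := ε_i − K Σ_{l=0}^{i−1} A^{i−1−l} B ε_l`. -/
def wErr {n N : ℕ} (A P : Matrix (Fin n) (Fin n) ℝ) (B : Fin n → ℝ)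
    (ε : Fin N → ℝ) (i : Fin N) : ℝ :=
  ε i - Kgain A P B ⬝ᵥ
    (∑ l ∈ Finset.univ.filter (fun l : Fin N => (l : ℕ) < (i : ℕ)),
      ε l • ((A ^ ((i : ℕ) - 1 - (l : ℕ))) *ᵥ B))

/-- The controllability matrix `[B, AB, …, A^{n−1}B]`. -/
def Ctrb {n : ℕ} (A : Matrix (Fin n) (Fin n) ℝ) (B : Fin n → ℝ) :
    Matrix (Fin n) (Fin n) ℝ :=
  Matrix.of fun r j => ((A ^ (j : ℕ)) *ᵥ B) r

/-- The state trajectory started at `x` with inputs `U`. -/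
def traj {n : ℕ} (A : Matrix (Fin n) (Fin n) ℝ) (B x : Fin n → ℝ) (U : ℕ → ℝ) :
    ℕ → (Fin n → ℝ)
  | 0 => x
  | k + 1 => A *ᵥ traj A B x U k + U k • B

theorem traj_closed {n : ℕ} (A : Matrix (Fin n) (Fin n) ℝ) (B x : Fin n → ℝ) (U : ℕ → ℝ)
    (k : ℕ) : traj A B x U (k + 1) =
      (A ^ (k + 1)) *ᵥ x + ∑ j ∈ Finset.range (k + 1), U j • ((A ^ (k - j)) *ᵥ B) := by
  induction k with
  | zero => simp [traj]
  | succ k ih =>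
    rw [traj, ih, Finset.sum_range_succ _ (k + 1), Matrix.mulVec_add, Matrix.mulVec_mulVec,
      ← pow_succ', Matrix.mulVec_sum, add_assoc]
    congr 2
    · refine Finset.sum_congr rfl fun j hj => ?_
      have hj' : k + 1 - j = (k - j) + 1 := by
        have := Finset.mem_range.mp hj
        omega
      rw [hj', pow_succ', ← Matrix.mulVec_mulVec, Matrix.mulVec_smul]
    · simp

theorem blocks_eq {n N : ℕ} (A : Matrix (Fin n) (Fin n) ℝ) (B x : Fin n → ℝ) (U : ℕ → ℝ)
    (i : Fin N) (r : Fin n) :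
    (Phi n N A B *ᵥ (fun j : Fin N => U j) + Upsilon n N A *ᵥ x) (i, r) =
      traj A B x U (i + 1) r := by
  rw [traj_closed, Pi.add_apply, Pi.add_apply, add_comm]
  congr 1
  rw [Finset.sum_apply]
  simp only [Matrix.mulVec, dotProduct, Phi, Matrix.of_apply]
  rw [Fin.sum_univ_eq_sum_range (fun j => (if j ≤ (i : ℕ) then
    ∑ s, (A ^ ((i : ℕ) - j)) r s * B s else 0) * U j) N]
  have hsub : Finset.range ((i : ℕ) + 1) ⊆ Finset.range N := by
    intro j hj
    have := Finset.mem_range.mp hj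
    exact Finset.mem_range.mpr (by omega)
  rw [← Finset.sum_subset hsub]
  · refine Finset.sum_congr rfl fun j hj => ?_
    have : j ≤ (i : ℕ) := by
      have := Finset.mem_range.mp hj
      omega
    rw [if_pos this]
    simp [mul_comm, Matrix.mulVec, dotProduct]
  · intro j _ hj
    have : ¬ j ≤ (i : ℕ) := by
      intro h
      exact hj (Finset.mem_range.mpr (by omega))
    rw [if_neg this, zero_mul]

theorem qbar_form {n M : ℕ} (Q P : Matrix (Fin n) (Fin n) ℝ) (y : Fin (M + 1) × Fin n → ℝ)
    (z : ℕ → Fin n → ℝ) (h : ∀ i r, y (i, r) = z ((i : ℕ) + 1) r) :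
    y ⬝ᵥ (Qbar n (M + 1) Q P *ᵥ y) =
      ∑ i ∈ Finset.range M, Vfun Q (z (i + 1)) + Vfun P (z (M + 1)) := by
  have h1 : y ⬝ᵥ (Qbar n (M + 1) Q P *ᵥ y) =
      ∑ i : Fin (M + 1), Vfun (if (i : ℕ) = M then P else Q) (z ((i : ℕ) + 1)) := by
    simp only [Vfun, dotProduct, Matrix.mulVec, Qbar, Matrix.of_apply, Fintype.sum_prod_type, h]
    refine Finset.sum_congr rfl fun i _ => Finset.sum_congr rfl fun r _ => ?_
    congr 1
    rw [Finset.sum_eq_single i]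
    · simp
    · intro j _ hj
      simp [Ne.symm hj]
    · simp
  rw [h1, Fin.sum_univ_eq_sum_range (fun i => Vfun (if i = M then P else Q) (z (i + 1))) (M + 1),
    Finset.sum_range_succ]
  congr 1
  · refine Finset.sum_congr rfl fun i hi => ?_
    rw [if_neg (Finset.mem_range.mp hi).ne]
  · simp

theorem jcost_eq {n M : ℕ} (A : Matrix (Fin n) (Fin n) ℝ) (B : Fin n → ℝ)
    (Q P : Matrix (Fin n) (Fin n) ℝ)
    (S : Matrix (Fin (M + 1) × Fin n) (Fin (M + 1) × Fin n) ℝ)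
    (hS : S.PosSemidef) (hSsq : S * S = Qbar n (M + 1) Q P) (x : Fin n → ℝ) (U : ℕ → ℝ) :
    Jcost (S * Phi n (M + 1) A B) (-(S * Upsilon n (M + 1) A)) x (fun j => U j) =
      ∑ i ∈ Finset.range M, Vfun Q (traj A B x U (i + 1)) + Vfun P (traj A B x U (M + 1)) := by
  rw [← qbar_form Q P _ (traj A B x U) (fun i r => blocks_eq A B x U i r), ← hSsq]
  have hT : Sᵀ = S := by
    have := hS.isHermitian
    simpa [Matrix.IsHermitian, Matrix.conjTranspose_eq_transpose_of_trivial] using this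
  unfold Jcost
  have : (S * Phi n (M + 1) A B) *ᵥ (fun j : Fin (M + 1) => U j) -
      (-(S * Upsilon n (M + 1) A)) *ᵥ x =
      S *ᵥ (Phi n (M + 1) A B *ᵥ (fun j : Fin (M + 1) => U j) + Upsilon n (M + 1) A *ᵥ x) := by
    rw [Matrix.neg_mulVec, sub_neg_eq_add, Matrix.mulVec_add, Matrix.mulVec_mulVec,
      Matrix.mulVec_mulVec]
  rw [this, ← Matrix.mulVec_mulVec]
  generalize Phi n (M + 1) A B *ᵥ (fun j : Fin (M + 1) => U j) + Upsilon n (M + 1) A *ᵥ x = y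
  rw [Matrix.dotProduct_mulVec y, ← Matrix.mulVec_transpose, hT]

theorem step_eq {n : ℕ} (A : Matrix (Fin n) (Fin n) ℝ) (B : Fin n → ℝ)
    (Q P : Matrix (Fin n) (Fin n) ℝ) (hT : Pᵀ = P) (hb : B ⬝ᵥ (P *ᵥ B) ≠ 0)
    (hRic : Riccati A P Q B) (z : Fin n → ℝ) (a : ℝ) :
    Vfun P (A *ᵥ z + a • B) = Vfun P z - Vfun Q z +
      (B ⬝ᵥ (P *ᵥ B)) * (a - Kgain A P B ⬝ᵥ z) ^ 2 := by
  have hsym : ∀ v w : Fin n → ℝ, v ⬝ᵥ (P *ᵥ w) = w ⬝ᵥ (P *ᵥ v) := by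
    intro v w
    rw [Matrix.dotProduct_mulVec, ← Matrix.mulVec_transpose, hT, dotProduct_comm]
  have hK : Kgain A P B ⬝ᵥ z = -((B ⬝ᵥ (P *ᵥ B))⁻¹ * (B ⬝ᵥ (P *ᵥ (A *ᵥ z)))) := by
    rw [Kgain, neg_dotProduct, smul_dotProduct, ← Matrix.dotProduct_mulVec,
      Matrix.mulVec_mulVec, smul_eq_mul]
  have hV : Vfun P z = Vfun P (A *ᵥ z) -
      (B ⬝ᵥ (P *ᵥ B))⁻¹ * (B ⬝ᵥ (P *ᵥ (A *ᵥ z))) ^ 2 + Vfun Q z := by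
    have h0 : Vfun P z = z ⬝ᵥ ((Aᵀ * P * A - (B ⬝ᵥ (P *ᵥ B))⁻¹ •
        Matrix.vecMulVec (Aᵀ *ᵥ (P *ᵥ B)) (Matrix.vecMul B (P * A)) + Q) *ᵥ z) := by
      unfold Vfun
      exact congrArg (fun R => z ⬝ᵥ (R *ᵥ z)) hRic
    have h1 : ∀ w : Fin n → ℝ, z ⬝ᵥ (Aᵀ *ᵥ w) = (A *ᵥ z) ⬝ᵥ w := by
      intro w
      rw [Matrix.dotProduct_mulVec, Matrix.vecMul_transpose]
    rw [h0, Matrix.add_mulVec, Matrix.sub_mulVec, dotProduct_add, dotProduct_sub,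
      Matrix.smul_mulVec, dotProduct_smul, Matrix.vecMulVec_mulVec, ← Matrix.mulVec_mulVec,
      ← Matrix.mulVec_mulVec, h1, ← Matrix.dotProduct_mulVec, ← Matrix.mulVec_mulVec]
    simp only [Vfun, smul_eq_mul, op_smul_eq_smul, dotProduct_smul]
    rw [h1, hsym (A *ᵥ z) B]
    ring
  rw [hV, hK]
  simp only [Vfun, Matrix.mulVec_add, Matrix.mulVec_smul, dotProduct_add, add_dotProduct,
    dotProduct_smul, smul_dotProduct, smul_eq_mul]
  rw [hsym (A *ᵥ z) B]
  field_simp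
  ring

theorem telescope {n : ℕ} (A : Matrix (Fin n) (Fin n) ℝ) (B : Fin n → ℝ)
    (Q P : Matrix (Fin n) (Fin n) ℝ) (hT : Pᵀ = P) (hb : B ⬝ᵥ (P *ᵥ B) ≠ 0)
    (hRic : Riccati A P Q B) (x : Fin n → ℝ) (U : ℕ → ℝ) (M : ℕ) :
    ∑ i ∈ Finset.range M, Vfun Q (traj A B x U (i + 1)) + Vfun P (traj A B x U (M + 1)) =
      Vfun P x - Vfun Q x + ∑ k ∈ Finset.range (M + 1),
        (B ⬝ᵥ (P *ᵥ B)) * (U k - Kgain A P B ⬝ᵥ traj A B x U k) ^ 2 := by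
  induction M with
  | zero =>
    simp only [Finset.range_zero, Finset.sum_empty, zero_add, Finset.sum_range_one]
    exact step_eq A B Q P hT hb hRic x (U 0)
  | succ M ih =>
    rw [Finset.sum_range_succ, Finset.sum_range_succ _ (M + 1)]
    have := step_eq A B Q P hT hb hRic (traj A B x U (M + 1)) (U (M + 1))
    rw [show traj A B x U (M + 1 + 1) = A *ᵥ traj A B x U (M + 1) + U (M + 1) • B from rfl]
    linarith

theorem traj_cl {n : ℕ} (A P : Matrix (Fin n) (Fin n) ℝ) (B x : Fin n → ℝ) (k : ℕ) :
    traj A B x (fun k => Kgain A P B ⬝ᵥ ((Acl A P B ^ k) *ᵥ x)) k = (Acl A P B ^ k) *ᵥ x := by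
  induction k with
  | zero => simp [traj]
  | succ k ih =>
    rw [traj, ih, pow_succ', ← Matrix.mulVec_mulVec]
    generalize (Acl A P B ^ k) *ᵥ x = z
    rw [Acl, Matrix.add_mulVec, Matrix.vecMulVec_mulVec, op_smul_eq_smul]

/-- If `P > 0` solves the DARE, then the minimal value of
`u ↦ ‖Gu − Hx‖₂²` equals `xᵀ(P−Q)x` for all `x`; that is, the smallest
covariance matrix is `W* = P − Q`. -/
theorem smallest_covariance_matrix {n N : ℕ} (hN : 1 ≤ N)
    (A : Matrix (Fin n) (Fin n) ℝ) (B : Fin n → ℝ) (hB : B ≠ 0)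
    (Q P : Matrix (Fin n) (Fin n) ℝ) (hQ : Q.PosDef) (hP : P.PosDef)
    (hRic : Riccati A P Q B)
    (S : Matrix (Fin N × Fin n) (Fin N × Fin n) ℝ)
    (hS : S.PosSemidef) (hSsq : S * S = Qbar n N Q P)
    (G : Matrix (Fin N × Fin n) (Fin N) ℝ) (hG : G = S * Phi n N A B)
    (H : Matrix (Fin N × Fin n) (Fin n) ℝ) (hH : H = -(S * Upsilon n N A)) :
    ∀ x : Fin n → ℝ,
      IsLeast (Set.range (Jcost G H x)) (x ⬝ᵥ ((P - Q) *ᵥ x)) := by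
  obtain ⟨M, rfl⟩ : ∃ M, N = M + 1 := ⟨N - 1, by omega⟩
  subst hG hH
  intro x
  have hT : Pᵀ = P := by
    have := hP.isHermitian
    simpa [Matrix.IsHermitian, Matrix.conjTranspose_eq_transpose_of_trivial] using this
  have hb : 0 < B ⬝ᵥ (P *ᵥ B) := by
    simpa using hP.dotProduct_mulVec_pos hB
  have hval : x ⬝ᵥ ((P - Q) *ᵥ x) = Vfun P x - Vfun Q x := by
    rw [Matrix.sub_mulVec, dotProduct_sub, Vfun, Vfun]
  rw [hval]
  constructor
  · refine ⟨fun j => Kgain A P B ⬝ᵥ ((Acl A P B ^ (j : ℕ)) *ᵥ x), ?_⟩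
    rw [jcost_eq A B Q P S hS hSsq x (fun k => Kgain A P B ⬝ᵥ ((Acl A P B ^ k) *ᵥ x)),
      telescope A B Q P hT hb.ne' hRic]
    simp [traj_cl]
  · rintro _ ⟨u, rfl⟩
    obtain ⟨U, rfl⟩ : ∃ U : ℕ → ℝ, u = fun j : Fin (M + 1) => U (j : ℕ) := by
      refine ⟨fun k => if h : k < M + 1 then u ⟨k, h⟩ else 0, ?_⟩
      funext j
      beta_reduce
      rw [dif_pos j.isLt]
    rw [jcost_eq A B Q P S hS hSsq x U, telescope A B Q P hT hb.ne' hRic]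
    have : 0 ≤ ∑ k ∈ Finset.range (M + 1), (B ⬝ᵥ (P *ᵥ B)) *
        (U k - Kgain A P B ⬝ᵥ traj A B x U k) ^ 2 :=
      Finset.sum_nonneg fun k _ => mul_nonneg hb.le (sq_nonneg _)
    linarith
end
end

section
/- (Open-loop bound, one step.) Suppose Q > 0, P > 0 solves the discrete algebraic Riccati equation, W > W* := P − Q, and set ℰ := W − W*. Let u ∈ F_W(x) and let x'_0 = x, x'_{i+1} = Ax'_i + Bu'_i be the predicted states under u. Then with V(x) := x^TPx and c₁ := max_{i=0,…,N−1} λ_max(Φ_i^TPΦ_i(G^TG)^{-1}), for every i = 0,…,N−1: V(x'_{i+1}) ≤ V(x'_i) − (x'_i)^TQ x'_i + c₁ · x^Tℰx. -/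
open Matrix Filter Topology

noncomputable section

/-- completion of squares residual -/
def wres {n : ℕ} (A P : Matrix (Fin n) (Fin n) ℝ) (B : Fin n → ℝ) (y : Fin n → ℝ) (v : ℝ) : ℝ :=
  v + (B ⬝ᵥ (P *ᵥ B))⁻¹ * (B ⬝ᵥ (P *ᵥ (A *ᵥ y)))

lemma bpos {n : ℕ} (P : Matrix (Fin n) (Fin n) ℝ) (hP : P.PosDef) (B : Fin n → ℝ) (hB : B ≠ 0) :
    0 < B ⬝ᵥ (P *ᵥ B) := by
  simpa using hP.dotProduct_mulVec_pos hB

lemma symm_dot {m : Type*} [Fintype m] (P : Matrix m m ℝ) (hP : Pᵀ = P) (y z : m → ℝ) :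
    y ⬝ᵥ (P *ᵥ z) = z ⬝ᵥ (P *ᵥ y) := by
  rw [Matrix.dotProduct_mulVec, ← Matrix.mulVec_transpose, hP, dotProduct_comm]

lemma one_step {n : ℕ} (A Q P : Matrix (Fin n) (Fin n) ℝ) (B : Fin n → ℝ) (hB : B ≠ 0)
    (hP : P.PosDef) (hRic : Riccati A P Q B) (y : Fin n → ℝ) (v : ℝ) :
    Vfun P (A *ᵥ y + v • B) = Vfun P y - y ⬝ᵥ (Q *ᵥ y)
      + (B ⬝ᵥ (P *ᵥ B)) * wres A P B y v ^ 2 := by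
  have hb := bpos P hP B hB
  have hPt : Pᵀ = P := by simpa using hP.isHermitian.eq
  have h1 : y ⬝ᵥ (P *ᵥ y) = (A *ᵥ y) ⬝ᵥ (P *ᵥ (A *ᵥ y))
      - (B ⬝ᵥ (P *ᵥ B))⁻¹ * (B ⬝ᵥ (P *ᵥ (A *ᵥ y))) ^ 2 + y ⬝ᵥ (Q *ᵥ y) := by
    have h2 : y ⬝ᵥ (P *ᵥ y) = y ⬝ᵥ ((Aᵀ * P * A -
      (B ⬝ᵥ (P *ᵥ B))⁻¹ •
        Matrix.vecMulVec (Aᵀ *ᵥ (P *ᵥ B)) (Matrix.vecMul B (P * A)) + Q) *ᵥ y) :=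
      congrArg (fun M => y ⬝ᵥ (M *ᵥ y)) hRic
    rw [h2, Matrix.add_mulVec, Matrix.sub_mulVec, dotProduct_add, dotProduct_sub,
      Matrix.smul_mulVec, dotProduct_smul, smul_eq_mul]
    have e1 : y ⬝ᵥ ((Aᵀ * P * A) *ᵥ y) = (A *ᵥ y) ⬝ᵥ (P *ᵥ (A *ᵥ y)) := by
      rw [← Matrix.mulVec_mulVec, ← Matrix.mulVec_mulVec, Matrix.dotProduct_mulVec,
        Matrix.vecMul_transpose]
    have e2 : y ⬝ᵥ (Matrix.vecMulVec (Aᵀ *ᵥ (P *ᵥ B)) (Matrix.vecMul B (P * A)) *ᵥ y)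
        = (B ⬝ᵥ (P *ᵥ (A *ᵥ y))) ^ 2 := by
      rw [Matrix.vecMulVec_mulVec, ← Matrix.dotProduct_mulVec, ← Matrix.mulVec_mulVec]
      have : y ⬝ᵥ (Aᵀ *ᵥ (P *ᵥ B)) = B ⬝ᵥ (P *ᵥ (A *ᵥ y)) := by
        rw [Matrix.dotProduct_mulVec, Matrix.vecMul_transpose, symm_dot P hPt]
      simp only [dotProduct_smul, this, sq, op_smul_eq_smul, smul_eq_mul]
    rw [e1, e2]
  unfold Vfun wres
  rw [h1, Matrix.mulVec_add, Matrix.mulVec_smul]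
  simp only [add_dotProduct, dotProduct_add, smul_dotProduct, dotProduct_smul, smul_eq_mul]
  rw [symm_dot P hPt (A *ᵥ y) B]
  field_simp
  ring

lemma traj_s13 {n N : ℕ} (A : Matrix (Fin n) (Fin n) ℝ) (B : Fin n → ℝ)
    (x : Fin n → ℝ) (u : Fin N → ℝ) (xs : ℕ → Fin n → ℝ) (hx0 : xs 0 = x)
    (hstep : ∀ i : Fin N, xs ((i : ℕ) + 1) = A *ᵥ xs i + u i • B) (k : ℕ) (hk : k ≤ N) :
    xs k = (A ^ k) *ᵥ x + ∑ j : Fin N, if (j : ℕ) < k then u j • ((A ^ (k - 1 - (j:ℕ))) *ᵥ B) else 0 := by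
  induction k with
  | zero => simp [hx0]
  | succ k ih =>
    have h := hstep ⟨k, hk⟩
    simp only at h
    rw [h, ih (by omega), Matrix.mulVec_add, Matrix.mulVec_mulVec, ← pow_succ', add_assoc]
    congr 1
    have e : u ⟨k, hk⟩ • B = ∑ j : Fin N, if j = ⟨k, hk⟩ then u j • B else 0 := by simp
    rw [e, Matrix.mulVec_sum, ← Finset.sum_add_distrib]
    refine Finset.sum_congr rfl fun j _ => ?_
    by_cases h1 : (j : ℕ) < k
    · have h2 : j ≠ ⟨k, hk⟩ := by rintro rfl; simp at h1
      rw [if_pos h1, if_neg h2, if_pos (by omega), Matrix.mulVec_smul, Matrix.mulVec_mulVec,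
        ← pow_succ', add_zero]
      congr 4
      omega
    · by_cases h2 : j = ⟨k, hk⟩
      · subst h2; simp
      · have h3 : ¬ (j : ℕ) < k + 1 := by
          intro h; apply h2; ext; simp; omega
        simp [h1, h2, h3]

lemma phi_traj {n N : ℕ} (A : Matrix (Fin n) (Fin n) ℝ) (B : Fin n → ℝ)
    (x : Fin n → ℝ) (u : Fin N → ℝ) (xs : ℕ → Fin n → ℝ) (hx0 : xs 0 = x)
    (hstep : ∀ i : Fin N, xs ((i : ℕ) + 1) = A *ᵥ xs i + u i • B) (p : Fin N × Fin n) :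
    (Phi n N A B *ᵥ u + Upsilon n N A *ᵥ x) p = xs ((p.1 : ℕ) + 1) p.2 := by
  rw [traj_s13 A B x u xs hx0 hstep _ (by omega), Pi.add_apply, Pi.add_apply, add_comm]
  congr 1
  rw [Finset.sum_apply, Matrix.mulVec, dotProduct]
  refine Finset.sum_congr rfl fun j _ => ?_
  simp only [Phi, Matrix.of_apply, Nat.lt_succ_iff, Nat.add_sub_cancel]
  split_ifs <;> simp [mul_comm]

lemma qbar_mulVec {n N : ℕ} (Q P : Matrix (Fin n) (Fin n) ℝ) (z : Fin N × Fin n → ℝ)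
    (p : Fin N × Fin n) : (Qbar n N Q P *ᵥ z) p =
      ((if (p.1 : ℕ) = N - 1 then P else Q) *ᵥ (fun r => z (p.1, r))) p.2 := by
  rw [Matrix.mulVec, dotProduct, Fintype.sum_prod_type, Finset.sum_eq_single p.1]
  · simp [Qbar, Matrix.mulVec, dotProduct]
  · intro b _ hb
    simp [Qbar, hb.symm]
  · simp

lemma cost_identity {n N : ℕ} (hN : 1 ≤ N)
    (A : Matrix (Fin n) (Fin n) ℝ) (B : Fin n → ℝ) (hB : B ≠ 0)
    (Q P : Matrix (Fin n) (Fin n) ℝ) (hP : P.PosDef)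
    (hRic : Riccati A P Q B)
    (S : Matrix (Fin N × Fin n) (Fin N × Fin n) ℝ)
    (hS : S.PosSemidef) (hSsq : S * S = Qbar n N Q P)
    (G : Matrix (Fin N × Fin n) (Fin N) ℝ) (hG : G = S * Phi n N A B)
    (H : Matrix (Fin N × Fin n) (Fin n) ℝ) (hH : H = -(S * Upsilon n N A))
    (x : Fin n → ℝ) (u : Fin N → ℝ)
    (xs : ℕ → Fin n → ℝ) (hx0 : xs 0 = x)
    (hstep : ∀ i : Fin N, xs ((i : ℕ) + 1) = A *ᵥ xs i + u i • B) :
    Jcost G H x u = Vfun P x - x ⬝ᵥ (Q *ᵥ x)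
      + ∑ i : Fin N, (B ⬝ᵥ (P *ᵥ B)) * wres A P B (xs i) (u i) ^ 2 := by
  have hSt : Sᵀ = S := by simpa using hS.isHermitian.eq
  have e1 : G *ᵥ u - H *ᵥ x = S *ᵥ (Phi n N A B *ᵥ u + Upsilon n N A *ᵥ x) := by
    rw [hG, hH, Matrix.neg_mulVec, sub_neg_eq_add, Matrix.mulVec_add, Matrix.mulVec_mulVec,
      Matrix.mulVec_mulVec]
  have e2 : Phi n N A B *ᵥ u + Upsilon n N A *ᵥ x = fun p => xs ((p.1 : ℕ) + 1) p.2 :=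
    funext fun p => phi_traj A B x u xs hx0 hstep p
  have e3 : Jcost G H x u = ∑ i : Fin N, xs ((i:ℕ)+1) ⬝ᵥ
      ((if (i : ℕ) = N - 1 then P else Q) *ᵥ xs ((i:ℕ)+1)) := by
    unfold Jcost
    rw [e1, Matrix.dotProduct_mulVec, ← Matrix.mulVec_transpose, hSt, Matrix.mulVec_mulVec, hSsq,
      e2, dotProduct_comm, dotProduct, Fintype.sum_prod_type]
    refine Finset.sum_congr rfl fun i _ => ?_
    rw [dotProduct]
    refine Finset.sum_congr rfl fun r _ => ?_
    rw [qbar_mulVec]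
  have e4 : ∀ i : Fin N, (B ⬝ᵥ (P *ᵥ B)) * wres A P B (xs i) (u i) ^ 2 =
      (Vfun P (xs ((i:ℕ)+1)) - Vfun P (xs i)) + xs i ⬝ᵥ (Q *ᵥ xs i) := by
    intro i
    rw [hstep, one_step A Q P B hB hP hRic]; ring
  rw [e3, Finset.sum_congr rfl fun i _ => e4 i, Finset.sum_add_distrib,
    Fin.sum_univ_eq_sum_range (fun i => Vfun P (xs (i+1)) - Vfun P (xs i)) N,
    Finset.sum_range_sub (fun i => Vfun P (xs i))]
  obtain ⟨M, rfl⟩ : ∃ M, N = M + 1 := ⟨N - 1, by omega⟩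
  rw [Fin.sum_univ_castSucc, Fin.sum_univ_succ (fun i : Fin (M+1) => xs i ⬝ᵥ (Q *ᵥ xs i))]
  have e5 : ∀ i : Fin M, (i : ℕ) ≠ M := fun i => by omega
  simp [e5, hx0, Vfun]
  ring

lemma gram_unit {n N : ℕ} (hN : 1 ≤ N)
    (A : Matrix (Fin n) (Fin n) ℝ) (B : Fin n → ℝ) (hB : B ≠ 0)
    (Q P : Matrix (Fin n) (Fin n) ℝ) (hP : P.PosDef)
    (hRic : Riccati A P Q B)
    (S : Matrix (Fin N × Fin n) (Fin N × Fin n) ℝ)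
    (hS : S.PosSemidef) (hSsq : S * S = Qbar n N Q P)
    (G : Matrix (Fin N × Fin n) (Fin N) ℝ) (hG : G = S * Phi n N A B) :
    IsUnit (Gᵀ * G) := by
  rw [← Matrix.mulVec_injective_iff_isUnit, ← Matrix.coe_mulVecLin, ← LinearMap.ker_eq_bot,
    LinearMap.ker_eq_bot']
  intro v hv
  have hv : (Gᵀ * G) *ᵥ v = 0 := hv
  have hGv : (G *ᵥ v) ⬝ᵥ (G *ᵥ v) = 0 := by
    have : v ⬝ᵥ ((Gᵀ * G) *ᵥ v) = 0 := by rw [hv]; simp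
    rwa [← Matrix.mulVec_mulVec, Matrix.dotProduct_mulVec, Matrix.vecMul_transpose] at this
  let xs : ℕ → Fin n → ℝ := fun k => Nat.rec 0 (fun i y => A *ᵥ y + (if h : i < N then v ⟨i, h⟩ else 0) • B) k
  have hstep : ∀ i : Fin N, xs ((i : ℕ) + 1) = A *ᵥ xs i + v i • B := by
    intro i
    change A *ᵥ xs i + (if h : (i:ℕ) < N then v ⟨i, h⟩ else 0) • B = _
    simp
  have hc := cost_identity hN A B hB Q P hP hRic S hS hSsq G hG _ rfl 0 v xs rfl hstep
  have hb := bpos P hP B hB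
  have hJ : Jcost G (-(S * Upsilon n N A)) 0 v = 0 := by simpa [Jcost] using hGv
  rw [hJ] at hc
  simp only [Vfun, Matrix.mulVec_zero, dotProduct_zero, sub_zero, zero_add] at hc
  have hw := (Finset.sum_eq_zero_iff_of_nonneg (fun i _ => by positivity)).1 hc.symm
  have hw' : ∀ i : Fin N, xs i = 0 → v i = 0 := by
    intro i hi
    have := hw i (Finset.mem_univ _)
    simpa [hb.ne', wres, hi] using this
  have hx : ∀ k, k ≤ N → xs k = 0 := by
    intro k
    induction k with
    | zero => intro _; rfl
    | succ k ih =>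
      intro hk
      have h0 := ih (by omega)
      have := hstep ⟨k, hk⟩
      simp only at this
      rw [this, h0, hw' ⟨k, hk⟩ h0]; simp
  ext i
  exact hw' i (hx i i.2.le)

lemma one_le_c1 {n N : ℕ} (hN : 1 ≤ N)
    (A : Matrix (Fin n) (Fin n) ℝ) (B : Fin n → ℝ) (hB : B ≠ 0)
    (Q P : Matrix (Fin n) (Fin n) ℝ) (hP : P.PosDef)
    (hRic : Riccati A P Q B)
    (S : Matrix (Fin N × Fin n) (Fin N × Fin n) ℝ)
    (hS : S.PosSemidef) (hSsq : S * S = Qbar n N Q P)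
    (G : Matrix (Fin N × Fin n) (Fin N) ℝ) (hG : G = S * Phi n N A B) :
    1 ≤ c1const n N A P B G := by
  have hU := gram_unit hN A B hB Q P hP hRic S hS hSsq G hG
  have hSt : Sᵀ = S := by simpa using hS.isHermitian.eq
  have hUd := (Matrix.isUnit_iff_isUnit_det _).1 hU
  let l : Fin N := ⟨N - 1, by omega⟩
  let e : Fin N → ℝ := Pi.single l 1
  have hGG : Gᵀ * G = (Phi n N A B)ᵀ * Qbar n N Q P * Phi n N A B := by
    rw [hG, Matrix.transpose_mul, hSt, ← hSsq]; simp only [Matrix.mul_assoc]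
  have hPe : ∀ p : Fin N × Fin n, (Phi n N A B *ᵥ e) p = if p.1 = l then B p.2 else 0 := by
    intro p
    have : (l : ℕ) ≤ p.1 ↔ p.1 = l := by
      rw [Fin.ext_iff]; have := p.1.2; simp only [l]; omega
    simp only [e, Matrix.mulVec_single_one, Matrix.col_apply, Phi, Matrix.of_apply, this]
    split_ifs with h
    · rw [h]; simp
    · rfl
  have hBe : PhiBlock n N A B l *ᵥ e = B := by
    ext r
    have := hPe (l, r)
    rw [if_pos rfl] at this
    exact this
  have key : ((PhiBlock n N A B l)ᵀ * P * PhiBlock n N A B l) *ᵥ e = (Gᵀ * G) *ᵥ e := by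
    rw [hGG, ← Matrix.mulVec_mulVec, hBe, ← Matrix.mulVec_mulVec, ← Matrix.mulVec_mulVec,
      ← Matrix.mulVec_mulVec]
    ext j
    rw [Matrix.mulVec, Matrix.mulVec, dotProduct, dotProduct, Fintype.sum_prod_type,
      Finset.sum_eq_single l]
    · refine Finset.sum_congr rfl fun r _ => ?_
      rw [qbar_mulVec]
      simp [hPe, PhiBlock, l]
    · intro b _ hb
      refine Finset.sum_eq_zero fun r _ => ?_
      rw [qbar_mulVec]
      simp only [hPe, hb, if_false]
      have : (fun _ : Fin n => (0:ℝ)) = 0 := rfl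
      simp [this]
    · simp
  have hmem : (1:ℝ) ∈ spectrum ℝ ((PhiBlock n N A B l)ᵀ * P * PhiBlock n N A B l * (Gᵀ * G)⁻¹) := by
    rw [← Matrix.spectrum_toLin', ← Module.End.hasEigenvalue_iff_mem_spectrum]
    refine Module.End.hasEigenvalue_of_hasEigenvector (x := (Gᵀ * G) *ᵥ e) ⟨?_, ?_⟩
    · rw [Module.End.mem_eigenspace_iff, Matrix.toLin'_apply, ← Matrix.mulVec_mulVec,
        Matrix.mulVec_mulVec e, Matrix.nonsing_inv_mul _ hUd, Matrix.one_mulVec, key, one_smul]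
    · intro h0
      have hinj := (Matrix.mulVec_injective_iff_isUnit).2 hU
      have : e = 0 := hinj (by rw [h0, Matrix.mulVec_zero])
      have := congrFun this l
      simp [e] at this
  refine le_trans (le_csSup (Matrix.finite_spectrum _).bddAbove hmem) ?_
  exact le_ciSup (f := fun i : Fin N => sSup (spectrum ℝ ((PhiBlock n N A B i)ᵀ * P * PhiBlock n N A B i * (Gᵀ * G)⁻¹))) (Set.finite_range _).bddAbove l

/-- Open-loop bound, one step: If `Q > 0`, `P > 0` solves the
DARE, `W > W* := P − Q`, `ℰ := W − W*`, `u ∈ F_W(x)` and `x'_0 = x`,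
`x'_{i+1} = Ax'_i + Bu'_i`, then for every `i = 0,…,N−1`:
`V(x'_{i+1}) ≤ V(x'_i) − x'_iᵀQx'_i + c₁ · xᵀℰx`. -/
theorem open_loop_bound_one_step {n N : ℕ} (hN : 1 ≤ N)
    (A : Matrix (Fin n) (Fin n) ℝ) (B : Fin n → ℝ) (hB : B ≠ 0)
    (Q P : Matrix (Fin n) (Fin n) ℝ) (hQ : Q.PosDef) (hP : P.PosDef)
    (hRic : Riccati A P Q B)
    (S : Matrix (Fin N × Fin n) (Fin N × Fin n) ℝ)
    (hS : S.PosSemidef) (hSsq : S * S = Qbar n N Q P)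
    (G : Matrix (Fin N × Fin n) (Fin N) ℝ) (hG : G = S * Phi n N A B)
    (H : Matrix (Fin N × Fin n) (Fin n) ℝ) (hH : H = -(S * Upsilon n N A))
    (W : Matrix (Fin n) (Fin n) ℝ) (hW : (W - (P - Q)).PosDef)
    (x : Fin n → ℝ) (u : Fin N → ℝ) (hu : u ∈ Feas G H W x)
    (xs : ℕ → Fin n → ℝ) (hx0 : xs 0 = x)
    (hstep : ∀ i : Fin N, xs ((i : ℕ) + 1) = A *ᵥ xs i + u i • B) :
    ∀ i : Fin N,
      Vfun P (xs ((i : ℕ) + 1)) ≤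
        Vfun P (xs i) - xs i ⬝ᵥ (Q *ᵥ xs i) +
          c1const n N A P B G * (x ⬝ᵥ ((W - (P - Q)) *ᵥ x)) := by
  intro i
  have hb := bpos P hP B hB
  have hc := cost_identity hN A B hB Q P hP hRic S hS hSsq G hG H hH x u xs hx0 hstep
  have hc1 := one_le_c1 hN A B hB Q P hP hRic S hS hSsq G hG
  have hE : 0 ≤ x ⬝ᵥ ((W - (P - Q)) *ᵥ x) := by
    simpa using hW.posSemidef.dotProduct_mulVec_nonneg x
  have hu' : Jcost G H x u ≤ x ⬝ᵥ (W *ᵥ x) := hu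
  have hle : (B ⬝ᵥ (P *ᵥ B)) * wres A P B (xs i) (u i) ^ 2 ≤
      ∑ i : Fin N, (B ⬝ᵥ (P *ᵥ B)) * wres A P B (xs i) (u i) ^ 2 :=
    Finset.single_le_sum (f := fun i : Fin N => (B ⬝ᵥ (P *ᵥ B)) * wres A P B (xs i) (u i) ^ 2)
      (fun i _ => by positivity) (Finset.mem_univ i)
  have hEe : x ⬝ᵥ ((W - (P - Q)) *ᵥ x) = x ⬝ᵥ (W *ᵥ x) - (Vfun P x - x ⬝ᵥ (Q *ᵥ x)) := by
    simp only [Vfun, Matrix.sub_mulVec, dotProduct_sub]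
  rw [hstep, one_step A Q P B hB hP hRic]
  nlinarith [mul_le_mul_of_nonneg_right hc1 hE]
end
end

section
/- (Strict Lyapunov decrease over one packet.) Suppose in addition that ℰ satisfies 0 < ℰ < (1−ρ)P/c in the Loewner order. Then for every x ≠ 0, every u ∈ F_W(x), and the associated predicted states x'_i under u, one has V(x'_i) ≤ ρV(x) + c·x^Tℰx < V(x) for all i = 1,…,N; in particular V strictly decreases at every step along the open-loop trajectory generated by any feasible packet. -/
open Matrix Filter Topology

noncomputable section

section Helpers

open scoped MatrixOrder in
/-- Spectral facts on `Q P⁻¹`: with `m` the infimum of the spectrum, `m P ≤ Q` and `m` is a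
generalized eigenvalue. -/
theorem aux_spec {n : ℕ} (hn : Nonempty (Fin n)) (Q P : Matrix (Fin n) (Fin n) ℝ)
    (hQ : Q.PosDef) (hP : P.PosDef) :
    (∀ z : Fin n → ℝ, sInf (spectrum ℝ (Q * P⁻¹)) * (z ⬝ᵥ (P *ᵥ z)) ≤ z ⬝ᵥ (Q *ᵥ z)) ∧
    ∃ z : Fin n → ℝ, z ≠ 0 ∧
      z ⬝ᵥ (Q *ᵥ z) = sInf (spectrum ℝ (Q * P⁻¹)) * (z ⬝ᵥ (P *ᵥ z)) := by
  obtain ⟨y, hy, hPy⟩ := CStarAlgebra.isStrictlyPositive_iff_eq_star_mul_self.mp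
    hP.isStrictlyPositive
  lift y to (Matrix (Fin n) (Fin n) ℝ)ˣ using hy
  set C : Matrix (Fin n) (Fin n) ℝ :=
    star ((y⁻¹ : (Matrix (Fin n) (Fin n) ℝ)ˣ) : Matrix (Fin n) (Fin n) ℝ) * Q *
      ((y⁻¹ : (Matrix (Fin n) (Fin n) ℝ)ˣ) : Matrix (Fin n) (Fin n) ℝ) with hC
  have hCherm : C.IsHermitian := isHermitian_conjTranspose_mul_mul _ hQ.isHermitian
  have hPinv : P⁻¹ = (y⁻¹ : (Matrix (Fin n) (Fin n) ℝ)ˣ) *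
      (((star y)⁻¹ : (Matrix (Fin n) (Fin n) ℝ)ˣ) : Matrix (Fin n) (Fin n) ℝ) := by
    apply Matrix.inv_eq_right_inv
    rw [hPy, mul_assoc, ← mul_assoc (y : Matrix (Fin n) (Fin n) ℝ), Units.mul_inv, one_mul,
      ← Units.coe_star, Units.mul_inv]
  have hsim : Q * P⁻¹ = (star y : (Matrix (Fin n) (Fin n) ℝ)ˣ) * C *
      (((star y)⁻¹ : (Matrix (Fin n) (Fin n) ℝ)ˣ) : Matrix (Fin n) (Fin n) ℝ) := by
    have h1 : ((star y : (Matrix (Fin n) (Fin n) ℝ)ˣ) : Matrix (Fin n) (Fin n) ℝ) *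
      star ((y⁻¹ : (Matrix (Fin n) (Fin n) ℝ)ˣ) : Matrix (Fin n) (Fin n) ℝ) = 1 := by
      rw [Units.coe_star, ← star_mul, Units.inv_mul, star_one]
    rw [hPinv, hC, ← mul_assoc, ← mul_assoc, ← mul_assoc, h1, one_mul]
  have hspec : spectrum ℝ (Q * P⁻¹) = spectrum ℝ C := by
    rw [hsim, spectrum.units_conjugate]
  have hne : (spectrum ℝ (Q * P⁻¹)).Nonempty := by
    rw [hspec, hCherm.spectrum_real_eq_range_eigenvalues]
    exact Set.range_nonempty _
  have hfin : (spectrum ℝ (Q * P⁻¹)).Finite := Matrix.finite_spectrum _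
  set m := sInf (spectrum ℝ (Q * P⁻¹)) with hm
  have hmem : m ∈ spectrum ℝ (Q * P⁻¹) := hne.csInf_mem hfin
  constructor
  · have hpsd : (C - algebraMap ℝ _ m).PosSemidef := by
      rw [posSemidef_iff_isHermitian_and_spectrum_nonneg]
      refine ⟨hCherm.sub ?_, ?_⟩
      · rw [Algebra.algebraMap_eq_smul_one]
        simp [Matrix.IsHermitian]
      · intro a ha
        have h2 : a + m ∈ spectrum ℝ C := by
          rw [spectrum.mem_iff] at ha ⊢
          intro h; apply ha
          convert h using 1
          rw [map_add]; abel
        rw [← hspec] at h2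
        have := csInf_le hfin.bddBelow h2
        simp only [Set.mem_ofPred_eq]
        linarith
    intro z
    have h3 := hpsd.conjTranspose_mul_mul_same (y : Matrix (Fin n) (Fin n) ℝ)
    have h4 : (y : Matrix (Fin n) (Fin n) ℝ)ᴴ * (C - algebraMap ℝ _ m) * y = Q - m • P := by
      rw [mul_sub, sub_mul, Algebra.algebraMap_eq_smul_one, hC, hPy]
      congr 1
      · rw [← star_eq_conjTranspose, ← mul_assoc, ← mul_assoc, ← star_mul, Units.inv_mul, star_one,
          one_mul, mul_assoc, Units.inv_mul, mul_one]
      · simp [star_eq_conjTranspose]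
    rw [h4] at h3
    have h5 := h3.dotProduct_mulVec_nonneg z
    simp only [star_trivial, sub_mulVec, dotProduct_sub, smul_mulVec, dotProduct_smul,
      smul_eq_mul] at h5
    linarith
  · rw [spectrum.mem_iff, Matrix.isUnit_iff_isUnit_det, isUnit_iff_ne_zero, not_not,
      ← Matrix.exists_mulVec_eq_zero_iff] at hmem
    obtain ⟨v, hv, hv0⟩ := hmem
    have hPu : IsUnit P.det := (Matrix.isUnit_iff_isUnit_det _).1 hP.isUnit
    have hPv : P *ᵥ (P⁻¹ *ᵥ v) = v := by
      rw [mulVec_mulVec, Matrix.mul_nonsing_inv _ hPu, one_mulVec]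
    refine ⟨P⁻¹ *ᵥ v, ?_, ?_⟩
    · intro h
      rw [h, mulVec_zero] at hPv
      exact hv hPv.symm
    · rw [hPv, mulVec_mulVec]
      rw [Algebra.algebraMap_eq_smul_one, sub_mulVec, smul_mulVec, one_mulVec, sub_eq_zero] at hv0
      rw [← hv0, dotProduct_smul, smul_eq_mul]

/-- One-step identity (completion of squares), bilinear version. -/
theorem aux_step {n : ℕ} (A : Matrix (Fin n) (Fin n) ℝ) (B : Fin n → ℝ)
    (Q P : Matrix (Fin n) (Fin n) ℝ) (hPs : Pᵀ = P) (hr : B ⬝ᵥ (P *ᵥ B) ≠ 0)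
    (hRic : Riccati A P Q B) (x y : Fin n → ℝ) (a b : ℝ) :
    (A *ᵥ x + a • B) ⬝ᵥ (P *ᵥ (A *ᵥ y + b • B)) + x ⬝ᵥ (Q *ᵥ y) =
      x ⬝ᵥ (P *ᵥ y) + (B ⬝ᵥ (P *ᵥ B)) *
        ((a - Kgain A P B ⬝ᵥ x) * (b - Kgain A P B ⬝ᵥ y)) := by
  have hsym : ∀ s t : Fin n → ℝ, s ⬝ᵥ (P *ᵥ t) = t ⬝ᵥ (P *ᵥ s) := by
    intro s t
    rw [dotProduct_mulVec, ← mulVec_transpose, hPs, dotProduct_comm]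
  have hb : ∀ z : Fin n → ℝ, (Matrix.vecMul B (P * A)) ⬝ᵥ z = B ⬝ᵥ (P *ᵥ (A *ᵥ z)) := by
    intro z
    rw [← dotProduct_mulVec, mulVec_mulVec]
  have hK : ∀ z : Fin n → ℝ, Kgain A P B ⬝ᵥ z =
      -((B ⬝ᵥ (P *ᵥ B))⁻¹ * (B ⬝ᵥ (P *ᵥ (A *ᵥ z)))) := by
    intro z
    rw [Kgain, neg_dotProduct, smul_dotProduct, hb, smul_eq_mul]
  have hR : x ⬝ᵥ (P *ᵥ y) = (A *ᵥ x) ⬝ᵥ (P *ᵥ (A *ᵥ y)) -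
      (B ⬝ᵥ (P *ᵥ B))⁻¹ * ((B ⬝ᵥ (P *ᵥ (A *ᵥ x))) * (B ⬝ᵥ (P *ᵥ (A *ᵥ y)))) +
      x ⬝ᵥ (Q *ᵥ y) := by
    have h := congrArg (fun M => x ⬝ᵥ (M *ᵥ y)) hRic
    simp only [add_mulVec, sub_mulVec, dotProduct_add, dotProduct_sub, smul_mulVec,
      dotProduct_smul, smul_eq_mul, vecMulVec_mulVec, hb] at h
    rw [h]
    have h1 : x ⬝ᵥ ((Aᵀ * P * A) *ᵥ y) = (A *ᵥ x) ⬝ᵥ (P *ᵥ (A *ᵥ y)) := by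
      rw [← mulVec_mulVec, ← mulVec_mulVec, dotProduct_mulVec, vecMul_transpose]
    have h2 : x ⬝ᵥ (Aᵀ *ᵥ (P *ᵥ B)) = B ⬝ᵥ (P *ᵥ (A *ᵥ x)) := by
      rw [dotProduct_mulVec, vecMul_transpose, hsym]
    rw [h1]
    rw [h2, op_smul_eq_mul]
  rw [hR, hK, hK]
  simp only [mulVec_add, mulVec_smul, dotProduct_add, add_dotProduct, smul_dotProduct,
    dotProduct_smul, smul_eq_mul]
  rw [hsym (A *ᵥ x) B]
  field_simp
  ring

/-- Telescoped identity. -/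
theorem aux_tele {n N : ℕ} (A : Matrix (Fin n) (Fin n) ℝ) (B : Fin n → ℝ)
    (Q P : Matrix (Fin n) (Fin n) ℝ) (hPs : Pᵀ = P) (hr : B ⬝ᵥ (P *ᵥ B) ≠ 0)
    (hRic : Riccati A P Q B) (xs ys : ℕ → Fin n → ℝ) (u v : ℕ → ℝ)
    (hx : ∀ i < N, xs (i + 1) = A *ᵥ xs i + u i • B)
    (hy : ∀ i < N, ys (i + 1) = A *ᵥ ys i + v i • B) (m : ℕ) (hm : m ≤ N) :
    xs m ⬝ᵥ (P *ᵥ ys m) + ∑ i ∈ Finset.range m, xs i ⬝ᵥ (Q *ᵥ ys i) =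
      xs 0 ⬝ᵥ (P *ᵥ ys 0) + (B ⬝ᵥ (P *ᵥ B)) * ∑ i ∈ Finset.range m,
        ((u i - Kgain A P B ⬝ᵥ xs i) * (v i - Kgain A P B ⬝ᵥ ys i)) := by
  induction m with
  | zero => simp
  | succ k ih =>
    have ih := ih (by omega)
    have h := aux_step A B Q P hPs hr hRic (xs k) (ys k) (u k) (v k)
    rw [← hx k (by omega), ← hy k (by omega)] at h
    rw [Finset.sum_range_succ, Finset.sum_range_succ, mul_add]
    linarith

/-- `Φ u + Υ x` stacks the predicted states. -/
theorem aux_pred {n N : ℕ} (A : Matrix (Fin n) (Fin n) ℝ) (B : Fin n → ℝ)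
    (xs : ℕ → Fin n → ℝ) (u : Fin N → ℝ)
    (hx : ∀ i : Fin N, xs ((i : ℕ) + 1) = A *ᵥ xs i + u i • B) (p : Fin N × Fin n) :
    (Phi n N A B *ᵥ u + Upsilon n N A *ᵥ xs 0) p = xs ((p.1 : ℕ) + 1) p.2 := by
  have key : ∀ (k : ℕ) (hk : k < N),
      xs (k + 1) = (∑ j : Fin N, u j • (if (j : ℕ) ≤ k then (A ^ (k - (j : ℕ))) *ᵥ B else 0))
        + (A ^ (k + 1)) *ᵥ xs 0 := by
    intro k
    induction k with
    | zero =>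
      intro hk
      rw [hx ⟨0, hk⟩, Finset.sum_eq_single (⟨0, hk⟩ : Fin N)]
      · simp [add_comm]
      · intro b _ hb
        have : (b : ℕ) ≠ 0 := fun h => hb (Fin.ext h)
        simp [this]
      · simp
    | succ k ih =>
      intro hk
      rw [hx ⟨k + 1, hk⟩]
      simp only
      rw [ih (by omega), mulVec_add, mulVec_mulVec, ← pow_succ', add_right_comm]
      congr 1
      have h1 : (A *ᵥ ∑ j : Fin N, u j • (if (j : ℕ) ≤ k then (A ^ (k - (j : ℕ))) *ᵥ B else 0))
          = ∑ j : Fin N, u j • (if (j : ℕ) ≤ k then (A ^ (k + 1 - (j : ℕ))) *ᵥ B else 0) := by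
        rw [mulVec_sum]
        refine Finset.sum_congr rfl fun j _ => ?_
        rw [mulVec_smul]
        congr 1
        split_ifs with h
        · rw [mulVec_mulVec, ← pow_succ']
          congr 2; omega
        · simp
      have h2 : u ⟨k + 1, hk⟩ • B = ∑ j : Fin N, u j • (if (j : ℕ) = k + 1 then B else 0) := by
        rw [Finset.sum_eq_single (⟨k + 1, hk⟩ : Fin N)]
        · simp
        · intro b _ hb
          have : (b : ℕ) ≠ k + 1 := fun h => hb (Fin.ext h)
          simp [this]
        · simp
      rw [h1, h2, ← Finset.sum_add_distrib]
      refine Finset.sum_congr rfl fun j _ => ?_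
      rw [← smul_add]
      congr 1
      rcases lt_trichotomy (j : ℕ) (k + 1) with h | h | h
      · rw [if_pos (by omega), if_neg (by omega), if_pos (by omega), add_zero]
      · rw [if_neg (by omega), if_pos h, if_pos (by omega), h]; simp
      · rw [if_neg (by omega), if_neg (by omega), if_neg (by omega), add_zero]
  rw [key p.1 p.1.2, Pi.add_apply, Pi.add_apply, Finset.sum_apply]
  congr 1
  simp only [mulVec, dotProduct, Phi, of_apply]
  refine Finset.sum_congr rfl fun j _ => ?_
  rw [Pi.smul_apply, smul_eq_mul, mul_comm]
  split_ifs <;> simp [mulVec, dotProduct]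

/-- Stacked quadratic form. -/
theorem aux_qbar {n N : ℕ} (hN : 1 ≤ N) (Q P : Matrix (Fin n) (Fin n) ℝ)
    (S : Matrix (Fin N × Fin n) (Fin N × Fin n) ℝ)
    (hS : S.PosSemidef) (hSsq : S * S = Qbar n N Q P)
    (xs ys : ℕ → Fin n → ℝ) (z w : Fin N × Fin n → ℝ)
    (hz : ∀ p, z p = xs ((p.1 : ℕ) + 1) p.2) (hw : ∀ p, w p = ys ((p.1 : ℕ) + 1) p.2) :
    (S *ᵥ z) ⬝ᵥ (S *ᵥ w) + xs 0 ⬝ᵥ (Q *ᵥ ys 0) =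
      xs N ⬝ᵥ (P *ᵥ ys N) + ∑ i ∈ Finset.range N, xs i ⬝ᵥ (Q *ᵥ ys i) := by
  have hSt : Sᵀ = S := by
    have := hS.isHermitian
    rwa [Matrix.IsHermitian, conjTranspose_eq_transpose_of_trivial] at this
  have h1 : (S *ᵥ z) ⬝ᵥ (S *ᵥ w) = z ⬝ᵥ (Qbar n N Q P *ᵥ w) := by
    rw [← hSsq, ← mulVec_mulVec, dotProduct_mulVec z, ← mulVec_transpose, hSt]
  obtain ⟨M, rfl⟩ : ∃ M, N = M + 1 := ⟨N - 1, by omega⟩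
  have h2 : z ⬝ᵥ (Qbar n (M + 1) Q P *ᵥ w) = ∑ i : Fin (M + 1),
      xs ((i : ℕ) + 1) ⬝ᵥ ((if (i : ℕ) = M then P else Q) *ᵥ ys ((i : ℕ) + 1)) := by
    simp only [dotProduct, mulVec, Fintype.sum_prod_type, Qbar, of_apply, hz, hw]
    refine Finset.sum_congr rfl fun i _ => Finset.sum_congr rfl fun r _ => ?_
    congr 1
    rw [Finset.sum_eq_single i]
    · simp
    · intro b _ hb
      simp [hb.symm]
    · simp
  rw [h1, h2, Fin.sum_univ_castSucc, Finset.sum_range_succ']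
  have h3 : ∀ i : Fin M, (i : ℕ) ≠ M := fun i => i.2.ne
  simp [h3, Finset.sum_range]
  ring

/-- Extension by zero. -/
def extU {N : ℕ} (u : Fin N → ℝ) (i : ℕ) : ℝ := if h : i < N then u ⟨i, h⟩ else 0

/-- Bilinear cost identity. -/
theorem aux_cost {n N : ℕ} (hN : 1 ≤ N) (A : Matrix (Fin n) (Fin n) ℝ) (B : Fin n → ℝ)
    (Q P : Matrix (Fin n) (Fin n) ℝ) (hPs : Pᵀ = P) (hr : B ⬝ᵥ (P *ᵥ B) ≠ 0)
    (hRic : Riccati A P Q B)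
    (S : Matrix (Fin N × Fin n) (Fin N × Fin n) ℝ)
    (hS : S.PosSemidef) (hSsq : S * S = Qbar n N Q P)
    (xs ys : ℕ → Fin n → ℝ) (u v : Fin N → ℝ)
    (hx : ∀ i : Fin N, xs ((i : ℕ) + 1) = A *ᵥ xs i + u i • B)
    (hy : ∀ i : Fin N, ys ((i : ℕ) + 1) = A *ᵥ ys i + v i • B) :
    (S *ᵥ (Phi n N A B *ᵥ u + Upsilon n N A *ᵥ xs 0)) ⬝ᵥ
      (S *ᵥ (Phi n N A B *ᵥ v + Upsilon n N A *ᵥ ys 0)) + xs 0 ⬝ᵥ (Q *ᵥ ys 0) =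
      xs 0 ⬝ᵥ (P *ᵥ ys 0) + (B ⬝ᵥ (P *ᵥ B)) * ∑ i ∈ Finset.range N,
        ((extU u i - Kgain A P B ⬝ᵥ xs i) * (extU v i - Kgain A P B ⬝ᵥ ys i)) := by
  rw [aux_qbar hN Q P S hS hSsq xs ys _ _ (aux_pred A B xs u hx) (aux_pred A B ys v hy)]
  apply aux_tele (N := N) A B Q P hPs hr hRic xs ys _ _ _ _ N le_rfl
  · intro i hi
    rw [hx ⟨i, hi⟩]; simp [extU, hi]
  · intro i hi
    rw [hy ⟨i, hi⟩]; simp [extU, hi]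

/-- Trajectory from zero. -/
def traj0 {n N : ℕ} (A : Matrix (Fin n) (Fin n) ℝ) (B : Fin n → ℝ) (u : Fin N → ℝ) :
    ℕ → Fin n → ℝ
  | 0 => 0
  | i + 1 => A *ᵥ traj0 A B u i + extU u i • B

/-- The impulse response of the closed loop. -/
def impY {n : ℕ} (A P : Matrix (Fin n) (Fin n) ℝ) (B : Fin n → ℝ) : ℕ → Fin n → ℝ
  | 0 => 0
  | 1 => B
  | i + 2 => A *ᵥ impY A P B (i + 1) + (Kgain A P B ⬝ᵥ impY A P B (i + 1)) • B

theorem aux_c1 {n N : ℕ} (hN : 1 ≤ N) (A : Matrix (Fin n) (Fin n) ℝ) (B : Fin n → ℝ)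
    (Q P : Matrix (Fin n) (Fin n) ℝ) (hPs : Pᵀ = P) (hr : 0 < B ⬝ᵥ (P *ᵥ B))
    (hRic : Riccati A P Q B)
    (S : Matrix (Fin N × Fin n) (Fin N × Fin n) ℝ)
    (hS : S.PosSemidef) (hSsq : S * S = Qbar n N Q P)
    (G : Matrix (Fin N × Fin n) (Fin N) ℝ) (hG : G = S * Phi n N A B) :
    1 ≤ c1const n N A P B G := by
  set r := B ⬝ᵥ (P *ᵥ B) with hrdef
  set K := Kgain A P B with hK
  have htraj : ∀ (u : Fin N → ℝ) (i : Fin N),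
      traj0 A B u ((i : ℕ) + 1) = A *ᵥ traj0 A B u i + u i • B := by
    intro u i
    simp [traj0, extU]
  have hdot : ∀ e v : Fin N → ℝ, e ⬝ᵥ ((Gᵀ * G) *ᵥ v) = (G *ᵥ e) ⬝ᵥ (G *ᵥ v) := by
    intro e v
    rw [← mulVec_mulVec, dotProduct_mulVec, vecMul_transpose]
  have hGv : ∀ e : Fin N → ℝ, ∀ z : ℕ → Fin n → ℝ, z 0 = 0 →
      G *ᵥ e = S *ᵥ (Phi n N A B *ᵥ e + Upsilon n N A *ᵥ z 0) := by
    intro e z hz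
    rw [hz, mulVec_zero, add_zero, mulVec_mulVec, hG]
  -- invertibility
  have hdet : (Gᵀ * G).det ≠ 0 := by
    intro h0
    obtain ⟨e, he, he0⟩ := Matrix.exists_mulVec_eq_zero_iff.mpr h0
    have h1 := hdot e e
    rw [he0, dotProduct_zero, hGv e (traj0 A B e) rfl] at h1
    have h2 := aux_cost hN A B Q P hPs hr.ne' hRic S hS hSsq (traj0 A B e) (traj0 A B e) e e
      (htraj e) (htraj e)
    rw [← h1] at h2
    simp only [traj0, zero_dotProduct, zero_add] at h2
    have h3 : ∑ i ∈ Finset.range N, ((extU e i - Kgain A P B ⬝ᵥ traj0 A B e i) *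
        (extU e i - Kgain A P B ⬝ᵥ traj0 A B e i)) = 0 := by
      rcases mul_eq_zero.mp h2.symm with h | h
      · exact absurd h hr.ne'
      · exact h
    rw [Finset.sum_eq_zero_iff_of_nonneg (fun i _ => mul_self_nonneg _)] at h3
    have h4 : ∀ i, i ≤ N → traj0 A B e i = 0 := by
      intro i
      induction i with
      | zero => intro _; rfl
      | succ k ih =>
        intro hk
        have ih := ih (by omega)
        have := mul_self_eq_zero.mp (h3 k (Finset.mem_range.2 (by omega)))
        rw [ih, dotProduct_zero, sub_zero] at this
        rw [traj0, ih, this]; simp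
    apply he
    ext i
    have := mul_self_eq_zero.mp (h3 i (Finset.mem_range.2 i.2))
    rw [h4 i i.2.le, dotProduct_zero, sub_zero] at this
    simpa [extU] using this
  -- impulse
  let v : Fin N → ℝ := fun i => if (i : ℕ) = 0 then 1 else K ⬝ᵥ impY A P B i
  have hv : ∀ i : Fin N, impY A P B ((i : ℕ) + 1) = A *ᵥ impY A P B i + v i • B := by
    rintro ⟨i, hi⟩
    rcases i with _ | i
    · simp [impY, v]
    · simp [impY, v, hK]
  let i0 : Fin N := ⟨0, hN⟩
  have hNv : (Gᵀ * G) *ᵥ v = r • Pi.single i0 1 := by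
    apply dotProduct_eq
    intro e
    have h2 := aux_cost hN A B Q P hPs hr.ne' hRic S hS hSsq (traj0 A B e) (impY A P B) e v
      (htraj e) hv
    rw [dotProduct_comm, hdot, hGv e (traj0 A B e) rfl, hGv v (impY A P B) rfl]
    simp only [traj0, impY, zero_dotProduct, zero_add, add_zero] at h2 ⊢
    rw [h2, Finset.sum_eq_single 0]
    · have h0 : 0 < N := hN
      simp [extU, h0, traj0, impY, v, i0, hrdef]
    · intro b hb hb0
      have hb' := Finset.mem_range.1 hb
      simp [extU, hb', v, hb0, hK]
    · intro h
      exact absurd (Finset.mem_range.2 hN) h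
  have hinv : (Gᵀ * G)⁻¹ *ᵥ Pi.single i0 1 = r⁻¹ • v := by
    have h1 : (Pi.single i0 1 : Fin N → ℝ) = (Gᵀ * G) *ᵥ (r⁻¹ • v) := by
      rw [mulVec_smul, hNv, smul_smul, inv_mul_cancel₀ hr.ne', one_smul]
    rw [h1, mulVec_mulVec, Matrix.nonsing_inv_mul _ (isUnit_iff_ne_zero.2 hdet), one_mulVec]
  have hPhi : ∀ p j, PhiBlock n N A B i0 p j = if (j : ℕ) = 0 then B p else 0 := by
    intro p j
    simp only [PhiBlock, Phi, of_apply, i0, Nat.le_zero]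
    split_ifs with h
    · simp
    · rfl
  have hPv : PhiBlock n N A B i0 *ᵥ v = B := by
    ext p
    simp only [mulVec, dotProduct, hPhi]
    rw [Finset.sum_eq_single i0]
    · simp [i0, v]
    · intro b _ hb
      have : (b : ℕ) ≠ 0 := fun h => hb (Fin.ext h)
      simp [this]
    · simp
  have hPt : (PhiBlock n N A B i0)ᵀ *ᵥ (P *ᵥ B) = r • Pi.single i0 1 := by
    ext j
    rw [mulVec, dotProduct]
    simp only [transpose_apply, hPhi]
    by_cases hj : (j : ℕ) = 0
    · have : j = i0 := Fin.ext hj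
      subst this
      simp [i0, hrdef, dotProduct]
    · have : j ≠ i0 := fun h => hj (by rw [h])
      simp [hj, this]
  have hmem : (1 : ℝ) ∈ spectrum ℝ
      ((PhiBlock n N A B i0)ᵀ * P * PhiBlock n N A B i0 * (Gᵀ * G)⁻¹) := by
    rw [spectrum.mem_iff, Matrix.isUnit_iff_isUnit_det, isUnit_iff_ne_zero, not_not,
      ← Matrix.exists_mulVec_eq_zero_iff]
    refine ⟨Pi.single i0 1, ?_, ?_⟩
    · intro h
      have := congrFun h i0
      simp at this
    · rw [map_one, sub_mulVec, one_mulVec, ← mulVec_mulVec, hinv, mulVec_smul, ← mulVec_mulVec,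
        hPv, ← mulVec_mulVec, hPt, smul_smul, inv_mul_cancel₀ hr.ne', one_smul, sub_self]
  have hb : 1 ≤ sSup (spectrum ℝ
      ((PhiBlock n N A B i0)ᵀ * P * PhiBlock n N A B i0 * (Gᵀ * G)⁻¹)) :=
    le_csSup (Matrix.finite_spectrum _).bddAbove hmem
  exact hb.trans (le_ciSup (f := fun i : Fin N => sSup (spectrum ℝ
      ((PhiBlock n N A B i)ᵀ * P * PhiBlock n N A B i * (Gᵀ * G)⁻¹)))
      (Set.finite_range _).bddAbove i0)

end Helpers

/-- Strict Lyapunov decrease over one packet: If additionally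
`0 < ℰ < (1−ρ)P/c` in the Loewner order, then for every `x ≠ 0`, every
`u ∈ F_W(x)` (with `W := (P−Q) + ℰ`) and the predicted states:
`V(x'_i) ≤ ρV(x) + c·xᵀℰx < V(x)` for all `i = 1,…,N`; in particular
`V(x'_i) < V(x)` along the open-loop trajectory of any feasible packet. -/
theorem strict_lyapunov_decrease_packet {n N : ℕ} (hN : 1 ≤ N)
    (A : Matrix (Fin n) (Fin n) ℝ) (B : Fin n → ℝ) (hB : B ≠ 0)
    (Q P : Matrix (Fin n) (Fin n) ℝ) (hQ : Q.PosDef) (hP : P.PosDef)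
    (hRic : Riccati A P Q B)
    (S : Matrix (Fin N × Fin n) (Fin N × Fin n) ℝ)
    (hS : S.PosSemidef) (hSsq : S * S = Qbar n N Q P)
    (G : Matrix (Fin N × Fin n) (Fin N) ℝ) (hG : G = S * Phi n N A B)
    (H : Matrix (Fin N × Fin n) (Fin n) ℝ) (hH : H = -(S * Upsilon n N A))
    (E : Matrix (Fin n) (Fin n) ℝ) (hE : E.PosDef)
    (hEub : (((1 - rhoConst Q P) / cConst n N A P Q B G) • P - E).PosDef)
    (x : Fin n → ℝ) (hx : x ≠ 0)
    (u : Fin N → ℝ) (hu : u ∈ Feas G H ((P - Q) + E) x)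
    (xs : ℕ → Fin n → ℝ) (hx0 : xs 0 = x)
    (hstep : ∀ i : Fin N, xs ((i : ℕ) + 1) = A *ᵥ xs i + u i • B) :
    ∀ i : ℕ, 1 ≤ i → i ≤ N →
      Vfun P (xs i) ≤
          rhoConst Q P * Vfun P x + cConst n N A P Q B G * (x ⬝ᵥ (E *ᵥ x)) ∧
      rhoConst Q P * Vfun P x + cConst n N A P Q B G * (x ⬝ᵥ (E *ᵥ x)) <
          Vfun P x ∧
      Vfun P (xs i) < Vfun P x := by
  have hPs : Pᵀ = P := by
    have := hP.isHermitian
    rwa [Matrix.IsHermitian, conjTranspose_eq_transpose_of_trivial] at this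
  have hr : 0 < B ⬝ᵥ (P *ᵥ B) := by simpa using hP.dotProduct_mulVec_pos hB
  have hn : Nonempty (Fin n) := by
    by_contra h
    rw [not_nonempty_iff] at h
    exact hB (Subsingleton.elim _ _)
  obtain ⟨hmu, z, hz, hzeq⟩ := aux_spec hn Q P hQ hP
  have hc1 := aux_c1 hN A B Q P hPs hr hRic S hS hSsq G hG
  have hrho : sInf (spectrum ℝ (Q * P⁻¹)) = 1 - rhoConst Q P := by
    rw [rhoConst]; ring
  rw [hrho] at hzeq hmu
  set ρ := rhoConst Q P with hρ
  have hVnn : ∀ y : Fin n → ℝ, 0 ≤ y ⬝ᵥ (P *ᵥ y) := fun y => by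
    simpa using hP.posSemidef.dotProduct_mulVec_nonneg y
  have hzP : 0 < z ⬝ᵥ (P *ᵥ z) := by simpa using hP.dotProduct_mulVec_pos hz
  have hzQ : 0 < z ⬝ᵥ (Q *ᵥ z) := by simpa using hQ.dotProduct_mulVec_pos hz
  have hρ1 : 0 < 1 - ρ := by
    rw [hzeq] at hzQ
    exact pos_of_mul_pos_left hzQ hzP.le
  have hρ0 : 0 ≤ ρ := by
    have h := aux_step A B Q P hPs hr.ne' hRic z z (Kgain A P B ⬝ᵥ z) (Kgain A P B ⬝ᵥ z)
    rw [sub_self, zero_mul, mul_zero, add_zero, hzeq] at h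
    have h2 := hVnn (A *ᵥ z + (Kgain A P B ⬝ᵥ z) • B)
    have h3 : 0 ≤ ρ * (z ⬝ᵥ (P *ᵥ z)) := by linarith
    exact nonneg_of_mul_nonneg_left h3 hzP
  have hc : 1 ≤ cConst n N A P Q B G := by
    have h1 : ρ ^ N ≤ ρ := by
      calc ρ ^ N ≤ ρ ^ 1 := pow_le_pow_of_le_one hρ0 (by linarith) hN
        _ = ρ := pow_one ρ
    have h2 : 1 ≤ (1 - ρ)⁻¹ * (1 - ρ ^ N) := by
      rw [inv_mul_eq_div, one_le_div hρ1]; linarith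
    rw [cConst, ← hρ]
    exact one_le_mul_of_one_le_of_one_le h2 hc1
  set c := cConst n N A P Q B G with hcdef
  have hcpos : 0 < c := by linarith
  have hEnn : 0 ≤ x ⬝ᵥ (E *ᵥ x) := by simpa using hE.posSemidef.dotProduct_mulVec_nonneg x
  have hlt : ρ * Vfun P x + c * (x ⬝ᵥ (E *ᵥ x)) < Vfun P x := by
    have h := hEub.dotProduct_mulVec_pos hx
    simp only [star_trivial, sub_mulVec, dotProduct_sub, smul_mulVec, dotProduct_smul,
      smul_eq_mul] at h
    have h2 : c * (x ⬝ᵥ (E *ᵥ x)) < (1 - ρ) * (x ⬝ᵥ (P *ᵥ x)) := by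
      have h3 := mul_pos hcpos h
      have h4 : c * ((1 - ρ) / c * (x ⬝ᵥ (P *ᵥ x)) - x ⬝ᵥ (E *ᵥ x)) =
          (1 - ρ) * (x ⬝ᵥ (P *ᵥ x)) - c * (x ⬝ᵥ (E *ᵥ x)) := by
        field_simp
      linarith
    rw [Vfun]; linarith
  -- feasibility bounds the deviation
  have hcost := aux_cost hN A B Q P hPs hr.ne' hRic S hS hSsq xs xs u u hstep hstep
  have hres : G *ᵥ u - H *ᵥ x =
      S *ᵥ (Phi n N A B *ᵥ u + Upsilon n N A *ᵥ xs 0) := by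
    rw [hG, hH, hx0, neg_mulVec, sub_neg_eq_add, mulVec_add, mulVec_mulVec, mulVec_mulVec]
  have hfeas : Jcost G H x u ≤ x ⬝ᵥ (((P - Q) + E) *ᵥ x) := hu
  rw [Jcost, hres, add_mulVec, sub_mulVec, dotProduct_add, dotProduct_sub] at hfeas
  rw [hx0] at hcost hfeas
  let w : ℕ → ℝ := fun i => (extU u i - Kgain A P B ⬝ᵥ xs i) * (extU u i - Kgain A P B ⬝ᵥ xs i)
  have hw0 : ∀ i, 0 ≤ w i := fun i => mul_self_nonneg _
  have hsum : (B ⬝ᵥ (P *ᵥ B)) * ∑ i ∈ Finset.range N, w i ≤ x ⬝ᵥ (E *ᵥ x) := by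
    simp only [w]; linarith
  have hone : ∀ i < N, Vfun P (xs (i + 1)) ≤ ρ * Vfun P (xs i) + (B ⬝ᵥ (P *ᵥ B)) * w i := by
    intro i hi
    have h := aux_step A B Q P hPs hr.ne' hRic (xs i) (xs i) (extU u i) (extU u i)
    have h1 : xs (i + 1) = A *ᵥ xs i + extU u i • B := by
      rw [hstep ⟨i, hi⟩]; simp [extU, hi]
    rw [← h1] at h
    have h2 := hmu (xs i)
    simp only [Vfun, w]
    linarith
  have hind : ∀ i, i + 1 ≤ N → Vfun P (xs (i + 1)) ≤
      ρ * Vfun P x + (B ⬝ᵥ (P *ᵥ B)) * ∑ l ∈ Finset.range (i + 1), w l := by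
    intro i
    induction i with
    | zero =>
      intro hi
      have := hone 0 (by omega)
      simpa [hx0] using this
    | succ k ih =>
      intro hi
      have ih := ih (by omega)
      have h := hone (k + 1) (by omega)
      rw [Finset.sum_range_succ, mul_add]
      have h0 : 0 ≤ Vfun P (xs (k + 1)) := hVnn _
      have h1 := mul_nonneg hρ1.le h0
      linarith
  intro i hi1 hiN
  have hmain : Vfun P (xs i) ≤ ρ * Vfun P x + c * (x ⬝ᵥ (E *ᵥ x)) := by
    obtain ⟨k, rfl⟩ : ∃ k, i = k + 1 := ⟨i - 1, by omega⟩
    have h1 := hind k hiN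
    have h2 : ∑ l ∈ Finset.range (k + 1), w l ≤ ∑ l ∈ Finset.range N, w l :=
      Finset.sum_le_sum_of_subset_of_nonneg (Finset.range_mono hiN) (fun j _ _ => hw0 j)
    have h3 := mul_le_mul_of_nonneg_left h2 hr.le
    have h4 : x ⬝ᵥ (E *ᵥ x) ≤ c * (x ⬝ᵥ (E *ᵥ x)) := le_mul_of_one_le_left hEnn hc
    linarith
  exact ⟨hmain, hlt, lt_of_le_of_lt hmain hlt⟩
end
end
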